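/- Let T be a weighted directed tree in which every edge of the underlying tree is replaced by two opposite arcs with arbitrary nonzero weights and there are no loops. Then the rank of the adjacency matrix of T equals twice the matching number of the underlying tree. -/

import Mathlib

open Matrix

section PendantVertex

variable {F V : Type*} [Field F] [Fintype V] [DecidableEq V]

/-- The matrix obtained from `A` by replacing the row and the column of index `u` by zero. -/
def Matrix.zeroCross (A : Matrix V V F) (u : V) : Matrix V V F :=
  Matrix.of fun i j => if i = u ∨ j = u then 0 else A i j

theorem Matrix.zeroCross_mulVec_apply (A : Matrix V V F) (u : V) (x : V → F) (i : V) :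
    (A.zeroCross u *ᵥ x) i = if i = u then 0 else (A *ᵥ x) i - A i u * x u := by
  by_cases hi : i = u
  · simp [Matrix.zeroCross, mulVec, dotProduct, hi]
  · rw [if_neg hi, eq_sub_iff_add_eq]
    simp only [Matrix.zeroCross, mulVec, dotProduct, of_apply, hi, false_or]
    rw [← Finset.add_sum_erase _ _ (Finset.mem_univ u),
      ← Finset.add_sum_erase (a := u) _ (fun j => A i j * x j) (Finset.mem_univ u)]
    rw [Finset.sum_congr rfl fun j hj => by rw [if_neg (Finset.ne_of_mem_erase hj)]]
    simp [add_comm]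

/-- If the only nonzero entries in row and column `v` are those at `u ≠ v`, then clearing row and
column `u` lowers the rank by exactly two. -/
theorem Matrix.rank_eq_rank_zeroCross_add_two (A : Matrix V V F) {u v : V} (huv : v ≠ u)
    (hvu : A v u ≠ 0) (hu : A u v ≠ 0) (hrow : ∀ w, w ≠ u → A v w = 0)
    (hcol : ∀ w, w ≠ u → A w v = 0) : A.rank = (A.zeroCross u).rank + 2 := by
  set B := A.zeroCross u with hB
  have hAv (x : V → F) : (A *ᵥ x) v = A v u * x u :=
    Finset.sum_eq_single u (fun w _ hw => by simp [hrow w hw]) (by simp)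
  have hle : LinearMap.ker A.mulVecLin ≤ LinearMap.ker B.mulVecLin := by
    intro x hx
    rw [LinearMap.mem_ker, mulVecLin_apply] at hx ⊢
    have hxu : x u = 0 := by simpa [hx, hvu] using hAv x
    ext i
    simp [hB, zeroCross_mulVec_apply, hx, hxu]
  let ψ : (V → F) →ₗ[F] F × F :=
    (LinearMap.proj u).prod ((LinearMap.proj u).comp A.mulVecLin)
  let φ := ψ.domRestrict (LinearMap.ker B.mulVecLin)
  have hker : LinearMap.ker φ =
      (LinearMap.ker A.mulVecLin).comap (LinearMap.ker B.mulVecLin).subtype := by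
    ext ⟨x, hx⟩
    rw [LinearMap.mem_ker, mulVecLin_apply] at hx
    rw [LinearMap.mem_ker, Submodule.mem_comap, LinearMap.mem_ker, Prod.ext_iff]
    change x u = 0 ∧ (A *ᵥ x) u = 0 ↔ A *ᵥ x = 0
    constructor
    · rintro ⟨hxu, hAu⟩
      ext i
      by_cases hi : i = u
      · simpa [hi] using hAu
      · simpa [hB, zeroCross_mulVec_apply, hi, hxu] using congrFun hx i
    · intro hA
      exact ⟨by simpa [hA, hvu] using hAv x, by simp [hA]⟩
  have hsurj : Function.Surjective φ := by
    rintro ⟨a, b⟩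
    let x : V → F := Pi.single u a + Pi.single v ((b - A u u * a) / A u v)
    have hxu : x u = a := by simp [x, huv.symm]
    refine ⟨⟨x, ?_⟩, Prod.ext hxu ?_⟩
    · rw [LinearMap.mem_ker, mulVecLin_apply]
      ext i
      rw [hB, zeroCross_mulVec_apply, hxu]
      by_cases hi : i = u
      · simp [hi]
      · simp [x, hi, mulVec_add, hcol i hi, mul_comm]
    · change (A *ᵥ x) u = b
      simp only [x, mulVec_add, Pi.add_apply, mulVec_single, Pi.smul_apply, col_apply,
        MulOpposite.smul_eq_mul_unop, MulOpposite.unop_op]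
      field_simp
      ring
  have h₁ := φ.finrank_range_add_finrank_ker
  rw [LinearMap.range_eq_top.mpr hsurj, finrank_top, Module.finrank_prod, Module.finrank_self,
    hker, (Submodule.comapSubtypeEquivOfLe hle).finrank_eq] at h₁
  have h₂ := A.mulVecLin.finrank_range_add_finrank_ker
  have h₃ := B.mulVecLin.finrank_range_add_finrank_ker
  simp only [Matrix.rank]
  omega

end PendantVertex

namespace SimpleGraph

variable {V : Type*} {G : SimpleGraph V}

/-- A finite acyclic graph with an edge has a vertex with exactly one neighbor. -/
theorem IsAcyclic.exists_existsUnique_adj [Finite V] (hG : G.IsAcyclic) (hne : G ≠ ⊥) :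
    ∃ v, ∃! u, G.Adj v u := by
  obtain ⟨a, b, hab⟩ := ne_bot_iff_exists_adj.mp hne
  have : Nonempty V := ⟨a⟩
  obtain ⟨u, v, p, hp, hmax⟩ := Walk.exists_isPath_forall_isPath_length_le_length G
  have hnil : ¬p.Nil := fun h => by
    have h₁ := hmax _ _ _ (Path.singleton hab).isPath
    have h₂ : p.length = 0 := Walk.length_eq_zero_iff.mpr h
    simp [h₂, Path.singleton] at h₁
  refine ⟨u, p.snd, p.adj_snd hnil, fun w hadj => hG.eq_snd_of_adj_start hp hadj ?_⟩
  by_contra hw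
  have := hmax _ _ _ (hp.cons (h := hadj.symm) hw)
  simp at this

/-- A matching has at most as many edges as a vertex cover has vertices. -/
theorem IsVertexCover.ncard_edgeSet_le [Finite V] {C : Set V} (hC : G.IsVertexCover C)
    {M : G.Subgraph} (hM : M.IsMatching) : M.edgeSet.ncard ≤ C.ncard := by
  have hex : ∀ e ∈ M.edgeSet, ∃ v ∈ C, v ∈ e := by
    intro e he
    induction e with
    | h a b =>
      rcases hC (M.adj_sub he) with h | h
      · exact ⟨a, h, by simp⟩
      · exact ⟨b, h, by simp⟩
  cases isEmpty_or_nonempty V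
  · simp [Set.eq_empty_of_isEmpty]
  choose! f hfC hf using hex
  refine Set.ncard_le_ncard_of_injOn f hfC fun e he e' he' hee' => ?_
  obtain ⟨a, ha⟩ := hf e he
  obtain ⟨b, hb⟩ := hf e' he'
  rw [← hee'] at hb
  rw [ha, Subgraph.mem_edgeSet] at he
  rw [hb, Subgraph.mem_edgeSet] at he'
  rw [ha, hb, hM.eq_of_adj_left he he']

/-- A matching of a subgraph in which the adjacent vertices `u` and `v` are isolated can be enlarged
by the edge between them. -/
theorem Subgraph.IsMatching.exists_ncard_edgeSet_eq_add_one [Finite V] {H : SimpleGraph V}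
    (hle : H ≤ G) {M : H.Subgraph} (hM : M.IsMatching) {u v : V} (huv : G.Adj v u)
    (hu : ∀ w, ¬H.Adj u w) (hv : ∀ w, ¬H.Adj v w) :
    ∃ N : G.Subgraph, N.IsMatching ∧ N.edgeSet.ncard = M.edgeSet.ncard + 1 := by
  refine ⟨M.map (Hom.ofLE hle) ⊔ G.subgraphOfAdj huv,
    (hM.map_ofLE hle).sup (.subgraphOfAdj huv) ?_, ?_⟩
  · rw [Set.disjoint_left]
    rintro a ⟨b, hab⟩ ha
    have hab : H.Adj a b := by simpa [Relation.map_apply] using M.adj_sub (by simpa using hab)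
    have : a = v ∨ a = u := by simpa using ha
    rcases this with rfl | rfl
    exacts [hv _ hab, hu _ hab]
  · have hedge : (M.map (Hom.ofLE hle)).edgeSet = M.edgeSet := by
      simp [Subgraph.edgeSet_map]
    rw [Subgraph.edgeSet_sup, hedge, edgeSet_subgraphOfAdj, Set.union_singleton,
      Set.ncard_insert_of_notMem]
    exact fun h => hv u (M.adj_sub h)

/-- For a matrix supported exactly on the edges of a finite acyclic graph, half the rank is the size
of a matching and bounds the size of some vertex cover. -/
theorem IsAcyclic.exists_isMatching_isVertexCover_rank {F : Type*} [Field F] [Fintype V]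
    [DecidableEq V] (hG : G.IsAcyclic) (A : Matrix V V F) (hA : ∀ u v, A u v ≠ 0 ↔ G.Adj u v) :
    ∃ (M : G.Subgraph) (C : Set V), M.IsMatching ∧ G.IsVertexCover C ∧
      C.ncard ≤ M.edgeSet.ncard ∧ A.rank = 2 * M.edgeSet.ncard := by
  induction G using WellFoundedLT.induction generalizing A with
  | ind G ih =>
  by_cases hbot : G = ⊥
  · subst hbot
    have hA0 : A = 0 := by
      ext i j
      simpa using hA i j
    exact ⟨⊥, ∅, fun v hv => hv.elim, by simp, by simp, by simp [hA0]⟩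
  obtain ⟨v, u, hvu, huniq⟩ := hG.exists_existsUnique_adj hbot
  have hrow (w : V) (hw : w ≠ u) : ¬G.Adj v w := fun h => hw (huniq w h)
  have hle := G.deleteIncidenceSet_le u
  have hlt : G.deleteIncidenceSet u < G := by
    refine hle.lt_of_ne fun h => ?_
    rw [← h, deleteIncidenceSet_adj] at hvu
    exact hvu.2.2 rfl
  obtain ⟨M, C, hM, hC, hCM, hrank⟩ := ih _ hlt (hG.anti hle) (A.zeroCross u) fun i j => by
    rw [deleteIncidenceSet_adj, ← hA]
    simp only [Matrix.zeroCross, Matrix.of_apply]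
    grind
  obtain ⟨N, hN, hNM⟩ := hM.exists_ncard_edgeSet_eq_add_one hle hvu
    (fun w hw => (deleteIncidenceSet_adj.mp hw).2.1 rfl)
    (fun w hw => have h := deleteIncidenceSet_adj.mp hw; hrow w h.2.2 h.1)
  refine ⟨N, insert u C, hN, fun a b hab => ?_, ?_, ?_⟩
  · have := @hC a b
    rw [deleteIncidenceSet_adj] at this
    grind
  · have := Set.ncard_insert_le u C
    omega
  · rw [A.rank_eq_rank_zeroCross_add_two hvu.ne ((hA _ _).mpr hvu) ((hA _ _).mpr hvu.symm)
      (fun w hw => by simpa using (hA v w).not.mpr (hrow w hw))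
      (fun w hw => by simpa using (hA w v).not.mpr fun h => hrow w hw h.symm), hrank, hNM]
    ring

end SimpleGraph

/-- for a loopless bi-arc tree (each tree edge replaced by two opposite
arcs of arbitrary nonzero weights, no loops), the rank of the adjacency matrix equals
twice the matching number of the underlying tree. -/
theorem stmt_14 {F : Type*} [Field F] {V : Type*} [Fintype V] [DecidableEq V]
    (G : SimpleGraph V) (hG : G.IsTree)
    (A : Matrix V V F)
    (hA : ∀ u v : V, A u v ≠ 0 ↔ G.Adj u v)
    (q : ℕ)
    (hq : (∃ M : G.Subgraph, M.IsMatching ∧ M.edgeSet.ncard = q) ∧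
      ∀ M : G.Subgraph, M.IsMatching → M.edgeSet.ncard ≤ q) :
    A.rank = 2 * q := by
  obtain ⟨⟨M₀, hM₀, rfl⟩, hmax⟩ := hq
  obtain ⟨M, C, hM, hC, hCM, hrank⟩ :=
    hG.isAcyclic.exists_isMatching_isVertexCover_rank A hA
  have := hmax M hM
  have := hC.ncard_edgeSet_le hM₀
  omega
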